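/- arXiv:1412.3608 — 3 statements merged into one kernel-verified Lean document; each statement's English description precedes it below -/
import Mathlib

section
/- Let d≥1 and let D:[0,∞)→(0,1] be a monotone nonincreasing function. Then there exist r_0>0 and a smooth diffeomorphism ψ:ℝ^d → S^d∖{N} (where S^d⊂ℝ^{d+1} is the unit d-sphere and N its north pole) such that: ψ(x)→N as |x|→∞; |∇ψ(x)| ≤ D(0) for all x∈ℝ^d; and |∇ψ(x)| ≤ D(|x|) for all x∈ℝ^d∖B_{r_0}. -/
open MeasureTheory Filter Set Metric Topology
open scoped ENNReal NNReal

noncomputable section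

/-- `Ed d` is the Euclidean space `ℝ^d`. -/
abbrev Ed (d : ℕ) : Type := EuclideanSpace ℝ (Fin d)

/-- The north pole `N = (0,…,0,1)` of the unit sphere `S^d ⊆ ℝ^{d+1}`. -/
noncomputable def northPole (d : ℕ) : Ed (d + 1) :=
  EuclideanSpace.single (Fin.last d) (1 : ℝ)

/-- A smooth positive function on `ℝ`, nearly constant (between `δ / 2` and `δ`) on `(-∞, S)` and
decaying faster than a prescribed positive antitone function on `[S + 1, ∞)`. -/
theorem exists_contDiff_density {E : ℝ → ℝ} (hE : Antitone E) (hE0 : ∀ s, 0 < E s)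
    (hE1 : ∀ s, E s ≤ 1) {δ S : ℝ} (hδ : 0 < δ) (hS : 0 ≤ S) :
    ∃ n : ℝ → ℝ, ContDiff ℝ (⊤ : ℕ∞) n ∧ (∀ s, 0 < n s) ∧ (∀ s, n s ≤ δ) ∧
      (∀ s < S, δ / 2 ≤ n s) ∧ ∀ s, S + 1 ≤ s → n s ≤ δ * E s * Real.exp (-s) := by
  set l : ℝ → ℝ := fun s => if s < S then δ / 2 else 0 with hl
  set u : ℝ → ℝ := fun s => if s < S + 1 then δ else δ * E s * Real.exp (-s) with hu
  have hexp : ∀ s, S + 1 ≤ s → Real.exp (-s) ≤ 1 := fun s hs =>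
    Real.exp_le_one_iff.2 (by linarith)
  have huδ : ∀ s, u s ≤ δ := by
    intro s
    simp only [hu]
    split_ifs with h
    · exact le_rfl
    · calc δ * E s * Real.exp (-s) ≤ δ * 1 * 1 := by
            gcongr
            · exact hE1 s
            · exact hexp s (not_lt.1 h)
        _ = δ := by ring
  have hloc : ∀ s : ℝ, ∃ c : ℝ, ∀ᶠ y in 𝓝 s, c ∈ Ioo (l y) (u y) := by
    intro s
    rcases lt_or_ge s (S + 1) with hs | hs
    · refine ⟨3 / 4 * δ, ?_⟩
      filter_upwards [Iio_mem_nhds hs] with y hy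
      simp only [hl, hu, if_pos (mem_Iio.1 hy)]
      constructor
      · split_ifs <;> linarith
      · linarith
    · have hpos : 0 < δ * E (s + 1) * Real.exp (-(s + 1)) :=
        mul_pos (mul_pos hδ (hE0 _)) (Real.exp_pos _)
      refine ⟨δ * E (s + 1) * Real.exp (-(s + 1)) / 2, ?_⟩
      have hS' : S < s := by linarith
      filter_upwards [Ioo_mem_nhds hS' (lt_add_one s)] with y hy
      simp only [hl, hu, if_neg (not_lt.2 hy.1.le)]
      refine ⟨by linarith, ?_⟩
      split_ifs with h
      · have h1 : δ * E (s + 1) * Real.exp (-(s + 1)) ≤ δ := by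
          have := huδ (s + 1)
          simpa only [hu, if_neg (show ¬ s + 1 < S + 1 by linarith)] using this
        linarith
      · have h1 : δ * E (s + 1) * Real.exp (-(s + 1)) ≤ δ * E y * Real.exp (-y) := by
          have := hE hy.2.le
          have := hE0 y
          have := hy.2.le
          gcongr
        linarith
  obtain ⟨g, hg⟩ := exists_contMDiffMap_forall_mem_convex_of_local_const (n := (⊤ : ℕ∞))
    (modelWithCornersSelf ℝ ℝ) (t := fun s => Ioo (l s) (u s)) (fun s => convex_Ioo _ _) hloc
  refine ⟨g, g.contMDiff.contDiff, fun s => ?_, fun s => (hg s).2.le.trans (huδ s),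
    fun s hs => ?_, fun s hs => ?_⟩
  · refine lt_of_le_of_lt ?_ (hg s).1
    simp only [hl]
    split_ifs <;> linarith
  · simpa only [hl, if_pos hs] using (hg s).1.le
  · simpa only [hu, if_neg (not_lt.2 hs)] using (hg s).2.le

/-- A smooth positive decreasing function with slope between `-δ` and `0`, which stays large up to
`S` and then decays, together with its slope, faster than a prescribed function `E`. -/
theorem exists_contDiff_decreasing_profile {E : ℝ → ℝ} (hE : Antitone E) (hE0 : ∀ s, 0 < E s)
    (hE1 : ∀ s, E s ≤ 1) {δ S : ℝ} (hδ : 0 < δ) (hS : 0 ≤ S) :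
    ∃ μ n : ℝ → ℝ, ContDiff ℝ (⊤ : ℕ∞) μ ∧ (∀ s, HasDerivAt μ (-n s) s) ∧ (∀ s, 0 < μ s) ∧
      (∀ s, 0 ≤ n s) ∧ (∀ s, n s ≤ δ) ∧ (∀ s ≤ S, δ / 2 * (S - s) ≤ μ s) ∧
      μ 0 ≤ δ * (S + 2) ∧ ∀ s, S + 1 ≤ s → μ s ≤ δ * E s ∧ n s ≤ δ * E s := by
  obtain ⟨n, hn, hn0, hnδ, hnS, hnE⟩ := exists_contDiff_density hE hE0 hE1 hδ hS
  have hexp : ∀ s, S + 1 ≤ s → Real.exp (-s) ≤ 1 := fun s hs =>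
    Real.exp_le_one_iff.2 (by linarith)
  have hint : ∀ a b : ℝ, IntervalIntegrable n volume a b := fun a b =>
    hn.continuous.intervalIntegrable a b
  have hdom : ∀ s, S + 1 ≤ s → ∀ t ∈ Ioi s, n t ≤ δ * E s * Real.exp (-t) := by
    intro s hs t ht
    refine (hnE t (hs.trans (mem_Ioi.1 ht).le)).trans ?_
    have := hE (mem_Ioi.1 ht).le
    gcongr
  have hIoi : ∀ s, S + 1 ≤ s → IntegrableOn n (Ioi s) := by
    intro s hs
    refine Integrable.mono' ((integrableOn_exp_neg_Ioi s).const_mul (δ * E s))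
      hn.continuous.aestronglyMeasurable ?_
    refine (ae_restrict_iff' measurableSet_Ioi).2 (Eventually.of_forall fun t ht => ?_)
    rw [Real.norm_of_nonneg (hn0 t).le]
    exact hdom s hs t ht
  set T := S + 1 with hT
  set μ : ℝ → ℝ := fun s => (∫ t in s..T, n t) + ∫ t in Ioi T, n t with hμ
  have htail : ∀ s, T ≤ s → μ s = ∫ t in Ioi s, n t := fun s hs =>
    intervalIntegral.integral_interval_add_Ioi' (hint s T) (hIoi T le_rfl)
  have hsub : ∀ a b, μ a = (∫ t in a..b, n t) + μ b := by
    intro a b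
    simp only [hμ]
    rw [← intervalIntegral.integral_add_adjacent_intervals (hint a b) (hint b T)]
    ring
  have htail_le : ∀ s, T ≤ s → μ s ≤ δ * E s := by
    intro s hs
    rw [htail s hs]
    calc ∫ t in Ioi s, n t ≤ ∫ t in Ioi s, δ * E s * Real.exp (-t) :=
          setIntegral_mono_on (hIoi s hs) ((integrableOn_exp_neg_Ioi s).const_mul _)
            measurableSet_Ioi (hdom s hs)
      _ = δ * E s * Real.exp (-s) := by rw [integral_const_mul, integral_exp_neg_Ioi]
      _ ≤ δ * E s * 1 := by
          have := hE0 s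
          gcongr
          exact hexp s hs
      _ = δ * E s := mul_one _
  have hderiv : ∀ s, HasDerivAt μ (-n s) s := fun s =>
    (intervalIntegral.integral_hasDerivAt_left (hint s T)
      (hn.continuous.stronglyMeasurableAtFilter _ _) hn.continuous.continuousAt).add_const _
  have hnonneg : ∀ s, 0 ≤ μ s := by
    intro s
    rw [hsub s (max s T), htail _ (le_max_right _ _)]
    exact add_nonneg (intervalIntegral.integral_nonneg (le_max_left _ _) fun t _ => (hn0 t).le)
      (setIntegral_nonneg measurableSet_Ioi fun t _ => (hn0 t).le)
  refine ⟨μ, n, ?_, hderiv, fun s => ?_, fun s => (hn0 s).le, hnδ, fun s hs => ?_, ?_,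
    fun s hs => ⟨htail_le s hs, ?_⟩⟩
  · refine contDiff_infty_iff_deriv.2 ⟨fun s => (hderiv s).differentiableAt, ?_⟩
    rw [funext fun s => (hderiv s).deriv]
    exact hn.neg
  · rw [hsub s (s + 1)]
    exact add_pos_of_pos_of_nonneg
      (intervalIntegral.intervalIntegral_pos_of_pos (hint _ _) hn0 (lt_add_one s)) (hnonneg _)
  · rw [hsub s S]
    have h := intervalIntegral.integral_mono_on_of_le_Ioo hs
      (intervalIntegrable_const (c := δ / 2)) (hint s S) fun t ht => hnS t ht.2
    rw [intervalIntegral.integral_const, smul_eq_mul] at h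
    linarith [hnonneg S]
  · rw [hsub 0 T]
    have hT0 : (0 : ℝ) ≤ T := by linarith
    have h := intervalIntegral.integral_mono_on hT0 (hint 0 T)
      (intervalIntegrable_const (c := δ)) fun t _ => hnδ t
    rw [intervalIntegral.integral_const, smul_eq_mul] at h
    have h2 : δ * E T ≤ δ * 1 := by
      gcongr
      exact hE1 T
    have h3 := htail_le T le_rfl
    nlinarith
  · calc n s ≤ δ * E s * Real.exp (-s) := hnE s hs
      _ ≤ δ * E s * 1 := by
          have := hE0 s
          gcongr
          exact hexp s hs
      _ = δ * E s := mul_one _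

/-- The profile `μ` for which the radial map `x ↦ x / μ(|x|²)`, followed by inverse stereographic
projection, has derivative of norm at most `E(|x|²)` outside a ball and at most `E(0)` everywhere. -/
theorem exists_damped_radial_profile {E : ℝ → ℝ} (hE : Antitone E) (hE0 : ∀ s, 0 < E s)
    (hE1 : ∀ s, E s ≤ 1) :
    ∃ (T : ℝ) (μ n : ℝ → ℝ), 1 ≤ T ∧ ContDiff ℝ (⊤ : ℕ∞) μ ∧ (∀ s, HasDerivAt μ (-n s) s) ∧
      (∀ s, 0 < μ s) ∧ (∀ s, 0 ≤ n s) ∧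
      (∀ s, 0 ≤ s → 2 * (μ s + 2 * s * n s) / (μ s ^ 2 + s) ≤ E 0) ∧
      ∀ s, T ≤ s → 2 * (μ s + 2 * s * n s) / (μ s ^ 2 + s) ≤ E s := by
  set e := E 0 with he
  have he0 : 0 < e := hE0 0
  have he1 : e ≤ 1 := hE1 0
  set δ := e / 16 with hδ
  have hδ0 : 0 < δ := by positivity
  set S := 256 / e ^ 2 with hS
  have hSe : S * e ^ 2 = 256 := by rw [hS]; field_simp
  have hS0 : 256 ≤ S := by
    rw [hS, le_div_iff₀ (by positivity)]
    nlinarith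
  obtain ⟨μ, n, hμ, hderiv, hμ0, hn0, hnδ, hlow, hup, htail⟩ :=
    exists_contDiff_decreasing_profile hE hE0 hE1 hδ0 (show 0 ≤ S by linarith)
  have hanti : Antitone μ := antitone_of_hasDerivAt_nonpos hderiv fun s => neg_nonpos.2 (hn0 s)
  refine ⟨S + 1, μ, n, by linarith, hμ, hderiv, hμ0, hn0, fun s hs => ?_, fun s hs => ?_⟩
  · have hm := hμ0 s
    rw [div_le_iff₀ (by positivity)]
    have h1 : s * n s ≤ s * δ := mul_le_mul_of_nonneg_left (hnδ s) hs
    suffices h : 2 * μ s ≤ e / 2 * (μ s ^ 2 + s) by nlinarith [sq_nonneg (μ s)]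
    rcases le_total s (S / 2) with h | h
    · have h2 : 4 ≤ e * μ s := by
        have h3 := hlow s (by linarith)
        have h4 : δ / 2 * (S / 2) ≤ δ / 2 * (S - s) := by
          gcongr
          linarith
        have h5 : e * (δ / 2 * (S / 2)) ≤ e * μ s := by
          gcongr
          exact h4.trans h3
        rw [hδ] at h5
        nlinarith
      nlinarith
    · have h2 : μ s ≤ δ * (S + 2) := (hanti hs).trans hup
      rw [hδ] at h2
      nlinarith [sq_nonneg (μ s)]
  · have hs0 : 0 < s := by linarith
    obtain ⟨h1, h2⟩ := htail s hs
    have hm := hμ0 s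
    have h3 := hE0 s
    rw [div_le_iff₀ (by positivity)]
    have h4 : s * n s ≤ s * (δ * E s) := mul_le_mul_of_nonneg_left h2 hs0.le
    have h5 : δ * E s ≤ 1 / 16 * E s := by
      gcongr
      linarith
    have h6 : s * (δ * E s) ≤ s * (1 / 16 * E s) := mul_le_mul_of_nonneg_left h5 hs0.le
    have h7 : E s ≤ s * E s := by nlinarith
    nlinarith [mul_pos h3 (sq_pos_of_pos hm)]

section RadialRescaling

variable {F : Type*} [NormedAddCommGroup F] [InnerProductSpace ℝ F]

/-- The radial map `x ↦ x / μ(|x|²)`. -/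
def radialRescale (μ : ℝ → ℝ) (x : F) : F := (μ (‖x‖ ^ 2))⁻¹ • x

variable {μ n : ℝ → ℝ}

theorem norm_radialRescale (hμ0 : ∀ s, 0 < μ s) (x : F) :
    ‖radialRescale μ x‖ = ‖x‖ / μ (‖x‖ ^ 2) := by
  rw [radialRescale, norm_smul, norm_inv, Real.norm_of_nonneg (hμ0 _).le, div_eq_inv_mul]

theorem contDiff_radialRescale (hμ : ContDiff ℝ (⊤ : ℕ∞) μ) (hμ0 : ∀ s, 0 < μ s) :
    ContDiff ℝ (⊤ : ℕ∞) (radialRescale μ : F → F) :=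
  ((hμ.comp (contDiff_norm_sq ℝ)).inv fun _ => (hμ0 _).ne').smul contDiff_id

theorem hasFDerivAt_radialRescale (hderiv : ∀ s, HasDerivAt μ (-n s) s) (hμ0 : ∀ s, 0 < μ s)
    (x : F) :
    HasFDerivAt (radialRescale μ)
      ((μ (‖x‖ ^ 2))⁻¹ • ContinuousLinearMap.id ℝ F +
        ((2 * n (‖x‖ ^ 2) / μ (‖x‖ ^ 2) ^ 2) • innerSL ℝ x).smulRight x) x := by
  have h1 : HasFDerivAt (fun y : F => ‖y‖ ^ 2) (2 • innerSL ℝ x) x :=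
    (hasStrictFDerivAt_norm_sq x).hasFDerivAt
  have h2 := ((hderiv (‖x‖ ^ 2)).inv (hμ0 _).ne').comp_hasFDerivAt x h1
  refine (h2.smul (hasFDerivAt_id x)).congr_fderiv ?_
  ext v
  simp
  congr 1
  ring

theorem norm_fderiv_radialRescale_le (hderiv : ∀ s, HasDerivAt μ (-n s) s) (hμ0 : ∀ s, 0 < μ s)
    (hn0 : ∀ s, 0 ≤ n s) (x : F) :
    ‖fderiv ℝ (radialRescale μ) x‖ ≤
      (μ (‖x‖ ^ 2) + 2 * ‖x‖ ^ 2 * n (‖x‖ ^ 2)) / μ (‖x‖ ^ 2) ^ 2 := by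
  rw [(hasFDerivAt_radialRescale hderiv hμ0 x).fderiv]
  set m := μ (‖x‖ ^ 2)
  have hm : 0 < m := hμ0 _
  have hk := hn0 (‖x‖ ^ 2)
  refine ContinuousLinearMap.opNorm_le_bound _ (by positivity) fun v => ?_
  simp only [add_apply, smul_apply, ContinuousLinearMap.coe_id', id,
    ContinuousLinearMap.smulRight_apply, innerSL_apply_apply, smul_eq_mul]
  refine (norm_add_le _ _).trans ?_
  rw [norm_smul, norm_smul, norm_mul, Real.norm_of_nonneg (inv_pos.2 hm).le,
    Real.norm_of_nonneg (show 0 ≤ 2 * n (‖x‖ ^ 2) / m ^ 2 by positivity)]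
  calc m⁻¹ * ‖v‖ + 2 * n (‖x‖ ^ 2) / m ^ 2 * ‖inner ℝ x v‖ * ‖x‖
      ≤ m⁻¹ * ‖v‖ + 2 * n (‖x‖ ^ 2) / m ^ 2 * (‖x‖ * ‖v‖) * ‖x‖ := by
        gcongr
        exact norm_inner_le_norm x v
    _ = (m + 2 * ‖x‖ ^ 2 * n (‖x‖ ^ 2)) / m ^ 2 * ‖v‖ := by
        field_simp

theorem injective_radialRescale (hanti : Antitone μ) (hμ0 : ∀ s, 0 < μ s) :
    Function.Injective (radialRescale μ : F → F) := by
  have hlt : ∀ x y : F, ‖x‖ < ‖y‖ → ‖radialRescale μ x‖ < ‖radialRescale μ y‖ := by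
    intro x y h
    rw [norm_radialRescale hμ0, norm_radialRescale hμ0]
    have h1 : μ (‖y‖ ^ 2) ≤ μ (‖x‖ ^ 2) := hanti (by gcongr)
    have h2 := hμ0 (‖x‖ ^ 2)
    have h3 := hμ0 (‖y‖ ^ 2)
    calc ‖x‖ / μ (‖x‖ ^ 2) < ‖y‖ / μ (‖x‖ ^ 2) := by gcongr
      _ ≤ ‖y‖ / μ (‖y‖ ^ 2) := by gcongr
  intro x y h
  have hnorm : ‖x‖ = ‖y‖ := by
    rcases lt_trichotomy ‖x‖ ‖y‖ with hxy | hxy | hxy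
    · exact absurd (congrArg norm h) (hlt x y hxy).ne
    · exact hxy
    · exact absurd (congrArg norm h) (hlt y x hxy).ne'
  simp only [radialRescale, hnorm] at h
  exact smul_right_injective F (inv_pos.2 (hμ0 _)).ne' h

theorem surjective_radialRescale (hcont : Continuous μ) (hanti : Antitone μ)
    (hμ0 : ∀ s, 0 < μ s) : Function.Surjective (radialRescale μ : F → F) := by
  intro y
  have hk : Continuous fun t : ℝ => t - μ ((t * ‖y‖) ^ 2) := by fun_prop
  have hmem : (0 : ℝ) ∈ Icc ((0 : ℝ) - μ ((0 * ‖y‖) ^ 2)) (μ 0 - μ ((μ 0 * ‖y‖) ^ 2)) :=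
    ⟨by linarith [hμ0 ((0 * ‖y‖) ^ 2)], sub_nonneg.2 (hanti (sq_nonneg _))⟩
  obtain ⟨t, ht, h⟩ := intermediate_value_Icc (hμ0 0).le hk.continuousOn hmem
  have hnorm : ‖t • y‖ = t * ‖y‖ := by rw [norm_smul, Real.norm_of_nonneg ht.1]
  refine ⟨t • y, ?_⟩
  rw [radialRescale, hnorm, ← sub_eq_zero.1 h, smul_smul, inv_mul_cancel₀, one_smul]
  rw [sub_eq_zero.1 h]
  exact (hμ0 _).ne'

/-- Radial rescaling has a smooth global inverse. -/
theorem exists_contDiff_inverse_radialRescale [FiniteDimensional ℝ F]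
    (hμ : ContDiff ℝ (⊤ : ℕ∞) μ) (hderiv : ∀ s, HasDerivAt μ (-n s) s)
    (hμ0 : ∀ s, 0 < μ s) (hn0 : ∀ s, 0 ≤ n s) :
    ∃ g : F → F, ContDiff ℝ (⊤ : ℕ∞) g ∧ (∀ x, g (radialRescale μ x) = x) ∧
      ∀ y, radialRescale μ (g y) = y := by
  have hanti : Antitone μ := antitone_of_hasDerivAt_nonpos hderiv fun s => neg_nonpos.2 (hn0 s)
  have hinj : Function.Injective (radialRescale μ : F → F) := injective_radialRescale hanti hμ0
  have hsurj : Function.Surjective (radialRescale μ : F → F) :=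
    surjective_radialRescale hμ.continuous hanti hμ0
  choose g hg using hsurj
  refine ⟨g, contDiff_iff_contDiffAt.2 fun y => ?_, fun x => hinj (hg _), hg⟩
  set x := g y
  have hx : radialRescale μ x = y := hg y
  have hf := hasFDerivAt_radialRescale hderiv hμ0 x
  set L := (μ (‖x‖ ^ 2))⁻¹ • ContinuousLinearMap.id ℝ F +
        ((2 * n (‖x‖ ^ 2) / μ (‖x‖ ^ 2) ^ 2) • innerSL ℝ x).smulRight x with hL
  have hLinj : Function.Injective L := by
    refine (injective_iff_map_eq_zero L).2 fun v hv => ?_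
    have h1 : inner ℝ (L v) v = 0 := by rw [hv, inner_zero_left]
    simp only [hL, add_apply, smul_apply, ContinuousLinearMap.coe_id', id,
      ContinuousLinearMap.smulRight_apply, innerSL_apply_apply, smul_eq_mul, inner_add_left,
      real_inner_smul_left, real_inner_self_eq_norm_sq] at h1
    have h2 := hn0 (‖x‖ ^ 2)
    have h3 : 0 ≤ 2 * n (‖x‖ ^ 2) / μ (‖x‖ ^ 2) ^ 2 * inner ℝ x v * inner ℝ x v := by
      rw [mul_assoc]
      exact mul_nonneg (by positivity) (mul_self_nonneg _)
    have h4 := inv_pos.2 (hμ0 (‖x‖ ^ 2))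
    by_contra hne
    have h5 : 0 < (μ (‖x‖ ^ 2))⁻¹ * ‖v‖ ^ 2 := mul_pos h4 (by positivity)
    linarith
  let e : F ≃L[ℝ] F :=
    (LinearEquiv.ofInjectiveEndo (L : F →ₗ[ℝ] F) hLinj).toContinuousLinearEquiv
  have he : (e : F →L[ℝ] F) = L := by
    ext v
    rfl
  have hf' : HasFDerivAt (radialRescale μ) (e : F →L[ℝ] F) x := by rwa [he]
  have hΦ : ContDiffAt ℝ (⊤ : ℕ∞) (radialRescale μ : F → F) x :=
    (contDiff_radialRescale hμ hμ0).contDiffAt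
  have hne : ((⊤ : ℕ∞) : WithTop ℕ∞) ≠ 0 := by simp
  have hloc := hΦ.to_localInverse hf' hne
  rw [hx] at hloc
  refine hloc.congr_of_eventuallyEq ?_
  have hright := (hΦ.hasStrictFDerivAt' hf' hne).eventually_right_inverse
  rw [hx] at hright
  filter_upwards [hright] with z hz
  exact hinj ((hg z).trans hz.symm)

end RadialRescaling

section StereographicInversion

open EuclideanGeometry

variable {V F : Type*} [NormedAddCommGroup V] [InnerProductSpace ℝ V]
  [NormedAddCommGroup F] [InnerProductSpace ℝ F] {N : V}

theorem dist_sq_eq_one_add_norm_sq (hN : ‖N‖ = 1) {z : V} (hz : inner ℝ z N = 0) :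
    dist z N ^ 2 = 1 + ‖z‖ ^ 2 := by
  rw [dist_eq_norm, norm_sub_sq_real, hz, hN]
  ring

theorem ne_of_inner_eq_zero (hN : ‖N‖ = 1) {z : V} (hz : inner ℝ z N = 0) : z ≠ N := by
  rintro rfl
  rw [real_inner_self_eq_norm_sq, hN] at hz
  norm_num at hz

/-- Inversion with centre `N` and radius `√2` maps the hyperplane `N^⊥` into the unit sphere. -/
theorem inversion_mem_sphere_of_inner_eq_zero (hN : ‖N‖ = 1) {z : V} (hz : inner ℝ z N = 0) :
    inversion N (√2) z ∈ sphere (0 : V) 1 \ {N} := by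
  have hR : √2 ≠ 0 := by positivity
  refine ⟨?_, fun h => ne_of_inner_eq_zero hN hz ((inversion_eq_center hR).1 h)⟩
  have hd := dist_sq_eq_one_add_norm_sq hN hz
  have hd' : ‖z - N‖ ^ 2 = 1 + ‖z‖ ^ 2 := by rwa [← dist_eq_norm]
  rw [mem_sphere_zero_iff_norm, ← sq_eq_sq₀ (norm_nonneg _) zero_le_one, inversion, vsub_eq_sub,
    vadd_eq_add, norm_add_sq_real, norm_smul, real_inner_smul_left, inner_sub_left, hz,
    real_inner_self_eq_norm_sq, hN, mul_pow, hd', div_pow, hd, Real.sq_sqrt zero_le_two,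
    Real.norm_of_nonneg (by positivity)]
  field_simp
  ring

/-- Inversion with centre `N` and radius `√2` maps the unit sphere into the hyperplane `N^⊥`. -/
theorem inner_inversion_eq_zero_of_mem_sphere (hN : ‖N‖ = 1) {p : V} (hp : ‖p‖ = 1)
    (hne : p ≠ N) : inner ℝ (inversion N (√2) p) N = 0 := by
  have hd : dist p N ^ 2 = 2 - 2 * inner ℝ p N := by
    rw [dist_eq_norm, norm_sub_sq_real, hp, hN]
    ring
  have hd0 : dist p N ≠ 0 := dist_ne_zero.2 hne
  rw [inversion, vsub_eq_sub, vadd_eq_add, inner_add_left, real_inner_smul_left, inner_sub_left,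
    real_inner_self_eq_norm_sq, hN, div_pow, Real.sq_sqrt zero_le_two]
  have h : inner ℝ p N = 1 - dist p N ^ 2 / 2 := by linarith
  rw [h]
  field_simp
  ring

theorem norm_fderiv_inversion_comp_le (hN : ‖N‖ = 1) (ι : F →ₗᵢ[ℝ] V)
    (hι : ∀ y, inner ℝ (ι y) N = 0) {f : F → F} {x : F} (hf : DifferentiableAt ℝ f x) :
    ‖fderiv ℝ (fun y => inversion N (√2) (ι (f y))) x‖ ≤
      2 / (1 + ‖f x‖ ^ 2) * ‖fderiv ℝ f x‖ := by
  have h1 := (hasFDerivAt_inversion (R := √2) (ne_of_inner_eq_zero hN (hι (f x)))).comp x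
    (ι.toContinuousLinearMap.hasFDerivAt.comp x hf.hasFDerivAt)
  have h2 : HasFDerivAt (fun y => inversion N (√2) (ι (f y))) _ x := h1
  rw [h2.fderiv, div_pow, Real.sq_sqrt zero_le_two, dist_sq_eq_one_add_norm_sq hN (hι _),
    ι.norm_map]
  refine ContinuousLinearMap.opNorm_le_bound _ (by positivity) fun v => ?_
  simp only [ContinuousLinearMap.comp_apply, smul_apply, norm_smul]
  rw [Real.norm_of_nonneg (by positivity), mul_assoc]
  gcongr
  calc _ = ‖fderiv ℝ f x v‖ := by simp
    _ ≤ _ := ContinuousLinearMap.le_opNorm _ _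

theorem tendsto_inversion_cobounded {R : ℝ} :
    Tendsto (inversion N R) (Bornology.cobounded V) (𝓝 N) := by
  refine tendsto_iff_dist_tendsto_zero.2 ?_
  simp_rw [dist_inversion_center]
  exact ((tendsto_dist_right_atTop_iff N).2 tendsto_id).const_div_atTop _

end StereographicInversion

theorem norm_northPole (d : ℕ) : ‖northPole d‖ = 1 := by
  simp [northPole]

/-- An isometric embedding of `ℝ^d` onto the hyperplane orthogonal to the north pole, together with
a continuous linear left inverse. -/
theorem exists_linearIsometry_orthogonal_northPole (d : ℕ) :
    ∃ (ι : Ed d →ₗᵢ[ℝ] Ed (d + 1)) (π : Ed (d + 1) →L[ℝ] Ed d),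
      (∀ y, inner ℝ (ι y) (northPole d) = 0) ∧ (∀ y, π (ι y) = y) ∧
      ∀ z, inner ℝ z (northPole d) = 0 → ι (π z) = z := by
  have hfact : Fact (Module.finrank ℝ (Ed (d + 1)) = d + 1) := ⟨by simp⟩
  have hN : northPole d ≠ 0 := by
    rw [← norm_ne_zero_iff, norm_northPole]
    exact one_ne_zero
  let K := (Submodule.span ℝ {northPole d})ᗮ
  let e : K ≃ₗᵢ[ℝ] Ed d := (OrthonormalBasis.fromOrthogonalSpanSingleton d hN).repr
  refine ⟨K.subtypeₗᵢ.comp e.symm.toLinearIsometry,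
    (e.toContinuousLinearEquiv : K →L[ℝ] Ed d).comp K.orthogonalProjectionOnto,
    fun y => ?_, fun y => ?_, fun z hz => ?_⟩
  · exact Submodule.mem_orthogonal_singleton_iff_inner_left.1 (e.symm y).2
  · simp
  · have hz' : z ∈ K := Submodule.mem_orthogonal_singleton_iff_inner_left.2 hz
    simpa using Submodule.starProjection_eq_self_iff.2 hz'

/-- Damped diffeomorphism onto the sphere minus the north pole: given a
monotone nonincreasing `D : [0,∞) → (0,1]`, there exist `r₀ > 0` and a smooth
diffeomorphism `ψ : ℝ^d → S^d ∖ {N}` such that `ψ(x) → N` as `|x| → ∞`,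
`|∇ψ(x)| ≤ D(0)` everywhere, and `|∇ψ(x)| ≤ D(|x|)` for `|x| ≥ r₀`. -/
theorem damped_diffeomorphism_onto_sphere
    (d : ℕ) (hd : 1 ≤ d) (D : ℝ → ℝ)
    (hD_pos : ∀ r, 0 ≤ r → 0 < D r) (hD_le : ∀ r, 0 ≤ r → D r ≤ 1)
    (hD_anti : AntitoneOn D (Ici 0)) :
    ∃ (r0 : ℝ) (ψ : Ed d → Ed (d + 1)) (g : Ed (d + 1) → Ed d),
      0 < r0 ∧
      -- ψ is a smooth diffeomorphism of ℝ^d onto S^d ∖ {N}, with smooth inverse g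
      ContDiff ℝ (⊤ : ℕ∞) ψ ∧
      Function.Injective ψ ∧
      range ψ = sphere (0 : Ed (d + 1)) 1 \ {northPole d} ∧
      ContDiffOn ℝ (⊤ : ℕ∞) g (sphere (0 : Ed (d + 1)) 1 \ {northPole d}) ∧
      (∀ x, g (ψ x) = x) ∧
      -- ψ(x) → N as |x| → ∞
      Tendsto ψ (Bornology.cobounded (Ed d)) (nhds (northPole d)) ∧
      -- gradient bounds
      (∀ x : Ed d, ‖fderiv ℝ ψ x‖ ≤ D 0) ∧
      (∀ x : Ed d, r0 ≤ ‖x‖ → ‖fderiv ℝ ψ x‖ ≤ D ‖x‖) := by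
  have hE : Antitone fun s => D (√s) := fun s t hst =>
    hD_anti (Real.sqrt_nonneg s) (Real.sqrt_nonneg t) (Real.sqrt_le_sqrt hst)
  obtain ⟨T, μ, n, hT, hμ, hderiv, hμ0, hn0, hglobal, htail⟩ :=
    exists_damped_radial_profile hE (fun s => hD_pos _ (Real.sqrt_nonneg s))
      fun s => hD_le _ (Real.sqrt_nonneg s)
  have hanti : Antitone μ := antitone_of_hasDerivAt_nonpos hderiv fun s => neg_nonpos.2 (hn0 s)
  obtain ⟨h, hh, hleft, hright⟩ :=
    exists_contDiff_inverse_radialRescale (F := Ed d) hμ hderiv hμ0 hn0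
  obtain ⟨ι, π, hι, hπι, hιπ⟩ := exists_linearIsometry_orthogonal_northPole d
  have hN := norm_northPole d
  have hR : √2 ≠ 0 := by positivity
  have hΦ : ContDiff ℝ (⊤ : ℕ∞) (radialRescale μ : Ed d → Ed d) := contDiff_radialRescale hμ hμ0
  set ψ : Ed d → Ed (d + 1) := fun x =>
    EuclideanGeometry.inversion (northPole d) (√2) (ι (radialRescale μ x)) with hψ
  set g : Ed (d + 1) → Ed d := fun p =>
    h (π (EuclideanGeometry.inversion (northPole d) (√2) p)) with hg
  have hgψ : ∀ x, g (ψ x) = x := fun x => by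
    simp only [hg, hψ, EuclideanGeometry.inversion_inversion _ hR, hπι, hleft]
  have hbound : ∀ x : Ed d, ‖fderiv ℝ ψ x‖ ≤
      2 * (μ (‖x‖ ^ 2) + 2 * ‖x‖ ^ 2 * n (‖x‖ ^ 2)) / (μ (‖x‖ ^ 2) ^ 2 + ‖x‖ ^ 2) := by
    intro x
    have hm := hμ0 (‖x‖ ^ 2)
    calc ‖fderiv ℝ ψ x‖ ≤ 2 / (1 + ‖radialRescale μ x‖ ^ 2) * ‖fderiv ℝ (radialRescale μ) x‖ :=
          norm_fderiv_inversion_comp_le hN ι hι (hΦ.differentiable (by simp) x)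
      _ ≤ 2 / (1 + ‖radialRescale μ x‖ ^ 2) *
            ((μ (‖x‖ ^ 2) + 2 * ‖x‖ ^ 2 * n (‖x‖ ^ 2)) / μ (‖x‖ ^ 2) ^ 2) := by
          gcongr
          exact norm_fderiv_radialRescale_le hderiv hμ0 hn0 x
      _ = _ := by
          rw [norm_radialRescale hμ0]
          field_simp
  refine ⟨T, ψ, g, by linarith, ?_, Function.LeftInverse.injective hgψ, ?_, ?_, hgψ, ?_,
    fun x => ?_, fun x hx => ?_⟩
  · exact contDiff_const.inversion contDiff_const (ι.contDiff.comp hΦ) fun x =>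
      ne_of_inner_eq_zero hN (hι _)
  · refine Subset.antisymm ?_ fun p hp => ⟨g p, ?_⟩
    · rintro _ ⟨x, rfl⟩
      exact inversion_mem_sphere_of_inner_eq_zero hN (hι _)
    · have hp0 := inner_inversion_eq_zero_of_mem_sphere hN (mem_sphere_zero_iff_norm.1 hp.1) hp.2
      simp only [hg, hψ, hright, hιπ _ hp0, EuclideanGeometry.inversion_inversion _ hR]
  · exact (hh.comp π.contDiff).comp_contDiffOn
      (contDiffOn_const.inversion contDiffOn_const contDiffOn_id fun p hp => hp.2)
  · refine tendsto_inversion_cobounded.comp (tendsto_norm_atTop_iff_cobounded.1 ?_)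
    simp_rw [ι.norm_map, norm_radialRescale hμ0]
    refine tendsto_atTop_mono (fun x => ?_) (tendsto_norm_cobounded_atTop.atTop_div_const (hμ0 0))
    have := hμ0 (‖x‖ ^ 2)
    have := hanti (sq_nonneg ‖x‖)
    gcongr
  · refine (hbound x).trans ((hglobal _ (sq_nonneg _)).trans_eq ?_)
    simp
  · refine (hbound x).trans ((htail _ ?_).trans_eq ?_)
    · nlinarith
    · simp

end
end

section
/- Let D_0:[0,∞)→(0,1] be a monotone nonincreasing function. Then there exist c_0∈(0,1) and a smooth, strictly increasing diffeomorphism ψ_0:[0,∞)→[0,π) such that: lim_{r→∞} ψ_0(r)=π; lim_{r→∞} ψ_0'(r)=0; ψ_0(r)=c_0 D_0(0) r for all r∈[0, π/D_0(0)); |ψ_0'(r)| ≤ D_0(0) for all r∈[0,∞); and |ψ_0'(r)| ≤ D_0(r) for all r∈[2π/D_0(0), ∞). -/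
open Filter Set Topology

noncomputable section

open MeasureTheory
open scoped ContDiff

/-- A positive antitone function on `[0, ∞)` has a smooth positive minorant which decays
exponentially. -/
theorem exists_contDiff_pos_lt_min_exp_neg {D : ℝ → ℝ} (hpos : ∀ r, 0 ≤ r → 0 < D r)
    (hanti : AntitoneOn D (Ici 0)) :
    ∃ h : ℝ → ℝ, ContDiff ℝ ∞ h ∧ (∀ r, 0 < h r) ∧
      ∀ r, 0 ≤ r → h r < D r ∧ h r < Real.exp (-r) := by
  obtain ⟨g, hg⟩ := exists_contMDiffMap_forall_mem_convex_of_local_const (n := (⊤ : ℕ∞))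
    (modelWithCornersSelf ℝ ℝ) (t := fun x : ℝ => Ioo 0 (min (D |x|) (Real.exp (-|x|))))
    (fun x => convex_Ioo _ _) (fun x => by
      have h0 : (0 : ℝ) ≤ |x| + 1 := by positivity
      have hm : 0 < min (D (|x| + 1)) (Real.exp (-(|x| + 1))) :=
        lt_min (hpos _ h0) (Real.exp_pos _)
      refine ⟨min (D (|x| + 1)) (Real.exp (-(|x| + 1))) / 2, ?_⟩
      have hnear : ∀ᶠ y in 𝓝 x, |y| < |x| + 1 :=
        continuous_abs.continuousAt.eventually_lt continuousAt_const (lt_add_one |x|)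
      filter_upwards [hnear] with y hy
      refine ⟨half_pos hm, (half_lt_self hm).trans_le (min_le_min ?_ ?_)⟩
      · exact hanti (abs_nonneg y) h0 hy.le
      · exact Real.exp_le_exp.2 (neg_le_neg hy.le))
  refine ⟨g, g.contMDiff.contDiff, fun r => (hg r).1, fun r hr => ?_⟩
  have := (hg r).2
  rw [abs_of_nonneg hr] at this
  exact lt_min_iff.1 this

/-- The primitive of a positive smooth integrable function on `[0, ∞)` is an increasing smooth
bijection onto `[0, L)`, where `L` is the total integral. -/
theorem primitive_smooth_bijection {f : ℝ → ℝ} {L : ℝ} (hf : ContDiff ℝ ∞ f)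
    (hpos : ∀ r, 0 < f r) (hint : IntegrableOn f (Ioi 0)) (hL : ∫ x in Ioi 0, f x = L) :
    ContDiff ℝ ∞ (fun r => ∫ x in (0 : ℝ)..r, f x) ∧
      (∀ r, HasDerivAt (fun r => ∫ x in (0 : ℝ)..r, f x) (f r) r) ∧
      StrictMono (fun r => ∫ x in (0 : ℝ)..r, f x) ∧
      (fun r => ∫ x in (0 : ℝ)..r, f x) '' Ici 0 = Ico 0 L ∧
      Tendsto (fun r => ∫ x in (0 : ℝ)..r, f x) atTop (𝓝 L) := by
  set F : ℝ → ℝ := fun r => ∫ x in (0 : ℝ)..r, f x with hF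
  have hderiv : ∀ r, HasDerivAt F (f r) r := fun r =>
    (hf.continuous.integral_hasStrictDerivAt 0 r).hasDerivAt
  have hF0 : F 0 = 0 := intervalIntegral.integral_same
  have hdF : deriv F = f := funext fun r => (hderiv r).deriv
  have hsmooth : ContDiff ℝ ∞ F :=
    contDiff_infty_iff_deriv.2 ⟨fun r => (hderiv r).differentiableAt, hdF ▸ hf⟩
  have hmono : StrictMono F := strictMono_of_deriv_pos fun r => hdF ▸ hpos r
  have hlim : Tendsto F atTop (𝓝 L) :=
    hL ▸ intervalIntegral_tendsto_integral_Ioi 0 hint tendsto_id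
  refine ⟨hsmooth, hderiv, hmono, ?_, hlim⟩
  ext y
  constructor
  · rintro ⟨r, hr, rfl⟩
    refine ⟨hF0 ▸ hmono.monotone hr, ?_⟩
    exact (hmono (lt_add_one r)).trans_le (hmono.monotone.ge_of_tendsto hlim _)
  · rintro ⟨hy0, hyL⟩
    obtain ⟨R, hR, hR0⟩ := ((hlim.eventually_const_lt hyL).and (eventually_ge_atTop 0)).exists
    obtain ⟨r, hr, rfl⟩ := intermediate_value_Icc hR0 hsmooth.continuous.continuousOn
      ⟨hF0.le.trans hy0, hR.le⟩
    exact ⟨r, hr.1, rfl⟩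

/-- A smooth step from `1` on `(-∞, a]` to `0` on `[2a, ∞)`, integrable on `[0, ∞)` with
integral at least `a`. -/
theorem exists_contDiff_step {a : ℝ} (ha : 0 < a) :
    ∃ φ : ℝ → ℝ, ContDiff ℝ ∞ φ ∧ (∀ r, 0 ≤ φ r) ∧ (∀ r, φ r ≤ 1) ∧ (∀ r, r ≤ a → φ r = 1) ∧
      (∀ r, 2 * a ≤ r → φ r = 0) ∧ IntegrableOn φ (Ioi 0) ∧ a ≤ ∫ x in Ioi 0, φ x := by
  set φ : ℝ → ℝ := fun r => 1 - Real.smoothTransition ((r - a) / a) with hφ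
  have hsmooth : ContDiff ℝ ∞ φ :=
    contDiff_const.sub (Real.smoothTransition.contDiff.comp
      ((contDiff_id.sub contDiff_const).div_const a))
  have h0 : ∀ r, 0 ≤ φ r := fun r => sub_nonneg.2 (Real.smoothTransition.le_one _)
  have h1 : ∀ r, φ r ≤ 1 := fun r => sub_le_self _ (Real.smoothTransition.nonneg _)
  have hone : ∀ r, r ≤ a → φ r = 1 := fun r hr => by
    rw [hφ]
    simp only
    rw [Real.smoothTransition.zero_of_nonpos
      (div_nonpos_of_nonpos_of_nonneg (sub_nonpos.2 hr) ha.le), sub_zero]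
  have hzero : ∀ r, 2 * a ≤ r → φ r = 0 := fun r hr => by
    rw [hφ]
    simp only
    rw [Real.smoothTransition.one_of_one_le ((one_le_div ha).2 (by linarith)), sub_self]
  have hint : IntegrableOn φ (Ioi 0) := by
    rw [← Ioc_union_Ioi_eq_Ioi (show (0 : ℝ) ≤ 2 * a by positivity)]
    refine (hsmooth.continuous.integrableOn_Ioc).union ?_
    exact integrableOn_zero.congr_fun (fun r hr => (hzero r (le_of_lt hr)).symm) measurableSet_Ioi
  refine ⟨φ, hsmooth, h0, h1, hone, hzero, hint, ?_⟩
  calc a = ∫ x in Ioc 0 a, (1 : ℝ) := by simp [ha.le]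
    _ = ∫ x in Ioc 0 a, φ x :=
      setIntegral_congr_fun measurableSet_Ioc fun x hx => (hone x hx.2).symm
    _ ≤ ∫ x in Ioi 0, φ x :=
      setIntegral_mono_set hint (ae_of_all _ h0) Ioc_subset_Ioi_self.eventuallyLE

/-- One-dimensional damped diffeomorphism: given a monotone
nonincreasing `D₀ : [0,∞) → (0,1]`, there exist `c₀ ∈ (0,1)` and a smooth, strictly
increasing diffeomorphism `ψ₀ : [0,∞) → [0,π)` such that `ψ₀(r) → π` and `ψ₀'(r) → 0`
as `r → ∞`, `ψ₀(r) = c₀ D₀(0) r` on `[0, π/D₀(0))`, `|ψ₀'(r)| ≤ D₀(0)` for all `r ≥ 0`,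
and `|ψ₀'(r)| ≤ D₀(r)` for `r ≥ 2π/D₀(0)`. -/
theorem one_dimensional_damped_diffeomorphism
    (D0 : ℝ → ℝ)
    (hD0_pos : ∀ r, 0 ≤ r → 0 < D0 r) (hD0_le : ∀ r, 0 ≤ r → D0 r ≤ 1)
    (hD0_anti : AntitoneOn D0 (Ici 0)) :
    ∃ (c0 : ℝ) (ψ0 : ℝ → ℝ),
      c0 ∈ Ioo (0:ℝ) 1 ∧
      -- ψ₀ is a smooth, strictly increasing diffeomorphism from [0,∞) onto [0,π)
      ContDiffOn ℝ (⊤ : ℕ∞) ψ0 (Ici 0) ∧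
      StrictMonoOn ψ0 (Ici 0) ∧
      ψ0 0 = 0 ∧
      ψ0 '' Ici 0 = Ico 0 Real.pi ∧
      -- limits at infinity
      Tendsto ψ0 atTop (nhds Real.pi) ∧
      Tendsto (fun r => derivWithin ψ0 (Ici 0) r) atTop (nhds 0) ∧
      -- linear behavior near the origin
      (∀ r ∈ Ico (0:ℝ) (Real.pi / D0 0), ψ0 r = c0 * D0 0 * r) ∧
      -- derivative bounds
      (∀ r, 0 ≤ r → |derivWithin ψ0 (Ici 0) r| ≤ D0 0) ∧
      (∀ r, 2 * Real.pi / D0 0 ≤ r → |derivWithin ψ0 (Ici 0) r| ≤ D0 r) := by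
  have hd : 0 < D0 0 := hD0_pos 0 le_rfl
  set d := D0 0
  set a := Real.pi / d with ha_def
  have ha : 0 < a := div_pos Real.pi_pos hd
  have hda : d * a = Real.pi := mul_div_cancel₀ _ hd.ne'
  obtain ⟨h, hh, hh_pos, hh_lt⟩ := exists_contDiff_pos_lt_min_exp_neg hD0_pos hD0_anti
  obtain ⟨φ, hφ, hφ0, hφ1, hφ_one, hφ_zero, hφ_int, hφ_mass⟩ := exists_contDiff_step ha
  set A := ∫ x in Ioi 0, φ x
  have hA : 0 < A := ha.trans_le hφ_mass
  have hdA : 0 < d * A := mul_pos hd hA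
  set t : ℝ → ℝ := fun r => (1 - φ r) * h r with ht
  have ht_smooth : ContDiff ℝ ∞ t := (contDiff_const.sub hφ).mul hh
  have ht0 : ∀ r, 0 ≤ t r := fun r => mul_nonneg (sub_nonneg.2 (hφ1 r)) (hh_pos r).le
  have ht_exp : ∀ r, 0 ≤ r → t r ≤ Real.exp (-r) := fun r hr =>
    (mul_le_of_le_one_left (hh_pos r).le (sub_le_self _ (hφ0 r))).trans (hh_lt r hr).2.le
  have ht_int : IntegrableOn t (Ioi 0) := by
    refine (integrableOn_exp_neg_Ioi 0).mono' ht_smooth.continuous.aestronglyMeasurable ?_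
    filter_upwards [ae_restrict_mem measurableSet_Ioi] with r hr
    rw [Real.norm_of_nonneg (ht0 r)]
    exact ht_exp r (le_of_lt hr)
  set B := ∫ x in Ioi 0, t x
  have hB0 : 0 < B := by
    refine (setIntegral_pos_iff_support_of_nonneg_ae (ae_of_all _ ht0) ht_int).2 ?_
    refine lt_of_lt_of_le ?_ (measure_mono (s := Ioi (2 * a)) fun r hr => ⟨?_, ?_⟩)
    · simp
    · simp [ht, hφ_zero r (le_of_lt hr), (hh_pos r).ne']
    · exact (mul_pos two_pos ha).trans hr
  have hB1 : B < Real.pi := by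
    have : B ≤ 1 := by
      rw [← integral_exp_neg_Ioi_zero]
      exact setIntegral_mono_on ht_int (integrableOn_exp_neg_Ioi 0) measurableSet_Ioi
        fun r hr => ht_exp r (le_of_lt hr)
    linarith [Real.pi_gt_three]
  set c := (Real.pi - B) / (d * A) with hc
  have hc0 : 0 < c := div_pos (sub_pos.2 hB1) hdA
  have hc1 : c < 1 := by
    rw [hc, div_lt_one hdA]
    nlinarith [mul_le_mul_of_nonneg_left hφ_mass hd.le]
  set f : ℝ → ℝ := fun r => c * d * φ r + t r with hf
  have hf_smooth : ContDiff ℝ ∞ f := (contDiff_const.mul hφ).add ht_smooth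
  have hf_pos : ∀ r, 0 < f r := fun r => by
    rcases (hφ0 r).eq_or_lt with h0 | h0
    · simp [hf, ht, ← h0, hh_pos r]
    · exact add_pos_of_pos_of_nonneg (by positivity) (ht0 r)
  have hf_int : IntegrableOn f (Ioi 0) := (hφ_int.const_mul _).add ht_int
  have hf_mass : ∫ x in Ioi 0, f x = Real.pi := by
    rw [hf, integral_add (hφ_int.const_mul _) ht_int, integral_const_mul]
    change c * d * A + B = Real.pi
    rw [hc, mul_assoc, div_mul_cancel₀ _ hdA.ne', sub_add_cancel]
  have hf_le : ∀ r, 0 ≤ r → f r ≤ d := fun r hr => by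
    have h1 : h r ≤ d := (hh_lt r hr).1.le.trans (hD0_anti self_mem_Ici hr hr)
    have h2 : c * d ≤ d := mul_le_of_le_one_left hd.le hc1.le
    calc f r ≤ d * φ r + (1 - φ r) * d :=
          add_le_add (mul_le_mul_of_nonneg_right h2 (hφ0 r))
            (mul_le_mul_of_nonneg_left h1 (sub_nonneg.2 (hφ1 r)))
      _ = d := by ring
  have hf_tail : ∀ r, 2 * a ≤ r → f r = h r := fun r hr => by simp [hf, ht, hφ_zero r hr]
  have hf_lim : Tendsto f atTop (𝓝 0) := by
    refine squeeze_zero' (Eventually.of_forall fun r => (hf_pos r).le) ?_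
      Real.tendsto_exp_neg_atTop_nhds_zero
    filter_upwards [eventually_ge_atTop (2 * a), eventually_ge_atTop 0] with r hr hr0
    exact hf_tail r hr ▸ (hh_lt r hr0).2.le
  obtain ⟨hψ_smooth, hψ_deriv, hψ_mono, hψ_image, hψ_lim⟩ :=
    primitive_smooth_bijection hf_smooth hf_pos hf_int hf_mass
  have hψ' : ∀ r, 0 ≤ r →
      derivWithin (fun r => ∫ x in (0 : ℝ)..r, f x) (Ici 0) r = f r := fun r hr =>
    (hψ_deriv r).hasDerivWithinAt.derivWithin (uniqueDiffOn_Ici 0 r hr)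
  refine ⟨c, fun r => ∫ x in (0 : ℝ)..r, f x, ⟨hc0, hc1⟩, hψ_smooth.contDiffOn,
    hψ_mono.strictMonoOn _, intervalIntegral.integral_same, hψ_image, hψ_lim, ?_, ?_, ?_, ?_⟩
  · refine hf_lim.congr' ?_
    filter_upwards [eventually_ge_atTop 0] with r hr using (hψ' r hr).symm
  · intro r hr
    have : EqOn f (fun _ => c * d) (uIcc 0 r) := fun x hx => by
      rw [uIcc_of_le hr.1] at hx
      simp [hf, ht, hφ_one x (hx.2.trans hr.2.le)]
    change ∫ x in (0 : ℝ)..r, f x = c * d * r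
    rw [intervalIntegral.integral_congr this, intervalIntegral.integral_const, smul_eq_mul,
      sub_zero, mul_comm]
  · intro r hr
    rw [hψ' r hr, abs_of_pos (hf_pos r)]
    exact hf_le r hr
  · intro r hr
    rw [mul_div_assoc] at hr
    have hr0 : 0 ≤ r := le_trans (by positivity) hr
    rw [hψ' r hr0, abs_of_pos (hf_pos r), hf_tail r hr]
    exact (hh_lt r hr0).1.le


end
end

section
/- Let d≥3 and H(x):=(c_d/(d−2))|x|^{2−d}, where c_d>0 is the dimensional constant such that c_d div(x/|x|^d)=δ_0. Then for every nonnegative ρ∈L^1(ℝ^d), ∫_{ℝ^d} (H∗ρ)(x) ρ(x) dx ≥ ∫_{ℝ^d} |(∇H∗ρ)(x)|^2 dx, where both sides take values in [0,+∞]. -/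
open MeasureTheory Filter Set Metric Topology
open scoped ENNReal NNReal

noncomputable section

/-- The dimensional constant `c_d` such that `c_d div(x/|x|^d) = δ₀`,
namely the reciprocal of the surface measure of the unit sphere. -/
noncomputable def cdim (d : ℕ) : ℝ :=
  ((d : ℝ) * (volume (ball (0 : Ed d) 1)).toReal)⁻¹

/-- The kernel `H(x) = (c_d/(d−2)) |x|^{2−d}`, with the convention `H(0) = +∞`
(valued in `[0,∞]`). -/
noncomputable def Hkern (d : ℕ) (x : Ed d) : ℝ≥0∞ :=
  ENNReal.ofReal (cdim d / ((d : ℝ) - 2)) * (ENNReal.ofReal ‖x‖) ^ ((2 : ℝ) - d)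

/-- The singular kernel `x/|x|^d`. -/
noncomputable def kern (d : ℕ) (x : Ed d) : Ed d := (‖x‖ ^ d)⁻¹ • x

/-- The convolution `(∇H ∗ ρ)(x) = −c_d ∫ (x−y)/|x−y|^d ρ(y) dy`. -/
noncomputable def gradHconv (d : ℕ) (ρ : Ed d → ℝ) (x : Ed d) : Ed d :=
  (-(cdim d)) • ∫ y : Ed d, ρ y • kern d (x - y)

section Polar

variable {E : Type*} [NormedAddCommGroup E] [NormedSpace ℝ E] [MeasurableSpace E] [BorelSpace E]
  [FiniteDimensional ℝ E] (μ : Measure E) [μ.IsAddHaarMeasure]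

theorem integrable_volumeIoiPow_iff {n : ℕ} {f : ℝ → ℝ} :
    Integrable (fun r : Ioi (0 : ℝ) ↦ f r) (Measure.volumeIoiPow n) ↔
      IntegrableOn (fun r ↦ r ^ n * f r) (Ioi 0) := by
  rw [integrableOn_iff_comap_subtypeVal measurableSet_Ioi, Measure.volumeIoiPow,
    integrable_withDensity_iff_integrable_smul' (by fun_prop) (by simp)]
  refine integrable_congr (.of_forall ?_)
  rintro ⟨x, hx : 0 < x⟩
  simp (disch := positivity) [ENNReal.toReal_ofReal]

theorem integral_volumeIoiPow (n : ℕ) (f : ℝ → ℝ) :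
    ∫ r : Ioi (0 : ℝ), f r ∂(Measure.volumeIoiPow n) = ∫ r in Ioi (0 : ℝ), r ^ n * f r := by
  simp only [Measure.volumeIoiPow, ENNReal.ofReal]
  rw [integral_withDensity_eq_integral_smul
      (measurable_subtype_coe.pow_const _).real_toNNReal,
    integral_subtype_comap measurableSet_Ioi fun a ↦ Real.toNNReal (a ^ n) • f a]
  refine setIntegral_congr_fun measurableSet_Ioi fun x hx ↦ ?_
  simp only [NNReal.smul_def, smul_eq_mul]
  rw [Real.coe_toNNReal _ (pow_nonneg (mem_Ioi.1 hx).le _)]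

theorem integrable_polar {f : E → ℝ} (hf : Integrable f μ) :
    Integrable (fun p : sphere (0 : E) 1 × Ioi (0 : ℝ) ↦ f ((p.2 : ℝ) • (p.1 : E)))
      (μ.toSphere.prod (Measure.volumeIoiPow (Module.finrank ℝ E - 1))) := by
  rw [← μ.measurePreserving_homeomorphUnitSphereProd.integrable_comp_emb
    (Homeomorph.measurableEmbedding _)]
  have h : IntegrableOn f {0}ᶜ μ := hf.integrableOn
  rw [integrableOn_iff_comap_subtypeVal (measurableSet_singleton _).compl] at h
  refine h.congr (.of_forall fun x ↦ ?_)
  have hx : ‖(x : E)‖ ≠ 0 := norm_ne_zero_iff.2 x.2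
  simp [smul_smul, hx]

/-- Almost every radial integrand of an integrable function is integrable. -/
theorem ae_integrableOn_ray {f : E → ℝ} (hf : Integrable f μ) :
    ∀ᵐ θ : sphere (0 : E) 1 ∂μ.toSphere,
      IntegrableOn (fun r : ℝ ↦ r ^ (Module.finrank ℝ E - 1) * f (r • (θ : E))) (Ioi 0) := by
  filter_upwards [(integrable_polar μ hf).prod_right_ae] with θ hθ
  exact integrable_volumeIoiPow_iff.1 hθ

theorem toSphere_singleton (h : 2 ≤ Module.finrank ℝ E) (θ : sphere (0 : E) 1) :
    μ.toSphere {θ} = 0 := by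
  rw [μ.toSphere_apply' (measurableSet_singleton _)]
  refine mul_eq_zero_of_right _ (measure_mono_null ?_
    (μ.addHaar_submodule (Submodule.span ℝ {(θ : E)}) fun htop ↦ ?_))
  · rintro _ ⟨r, -, _, ⟨_, rfl, rfl⟩, rfl⟩
    exact Submodule.smul_mem _ _ (Submodule.mem_span_singleton_self _)
  · have := finrank_span_le_card (R := ℝ) ({(θ : E)} : Set E)
    rw [htop, finrank_top] at this
    simp at this
    omega

variable [Nontrivial E]

/-- Integration in polar coordinates. -/
theorem integral_eq_integral_sphere_ray {f : E → ℝ} (hf : Integrable f μ) :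
    ∫ x, f x ∂μ = ∫ θ : sphere (0 : E) 1,
      (∫ r in Ioi (0 : ℝ), r ^ (Module.finrank ℝ E - 1) * f (r • (θ : E))) ∂μ.toSphere := by
  calc
    ∫ x, f x ∂μ = ∫ x : ({(0)}ᶜ : Set E), f x ∂(μ.comap (↑)) := by
      rw [integral_subtype_comap (measurableSet_singleton _).compl f, restrict_compl_singleton]
    _ = ∫ p : sphere (0 : E) 1 × Ioi (0 : ℝ), f ((p.2 : ℝ) • (p.1 : E))
          ∂(μ.toSphere.prod (Measure.volumeIoiPow (Module.finrank ℝ E - 1))) := by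
      rw [← μ.measurePreserving_homeomorphUnitSphereProd.integral_comp
        (Homeomorph.measurableEmbedding _)]
      refine integral_congr_ae (.of_forall fun x ↦ ?_)
      have hx : ‖(x : E)‖ ≠ 0 := norm_ne_zero_iff.2 x.2
      simp [smul_smul, hx]
    _ = _ := by
      rw [integral_prod _ (integrable_polar μ hf)]
      exact integral_congr_ae (.of_forall fun θ ↦
        integral_volumeIoiPow _ fun r ↦ f (r • (θ : E)))

end Polar

section Kernel

variable {d : ℕ}

theorem measurable_kern : Measurable (kern d) := by
  unfold kern
  fun_prop

theorem nontrivial_Ed (hd : 1 ≤ d) : Nontrivial (Ed d) :=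
  have : Nonempty (Fin d) := ⟨⟨0, by omega⟩⟩
  inferInstance

theorem norm_kern (hd : 2 ≤ d) (x : Ed d) : ‖kern d x‖ = (‖x‖ ^ (d - 1))⁻¹ := by
  obtain ⟨n, rfl⟩ : ∃ n, d = n + 2 := ⟨d - 2, by omega⟩
  rcases eq_or_ne x 0 with rfl | hx
  · simp [kern]
  · have : ‖x‖ ≠ 0 := norm_ne_zero_iff.2 hx
    rw [kern, norm_smul, norm_inv, norm_pow, norm_norm]
    simp only [show n + 2 - 1 = n + 1 by omega]
    field_simp
    ring

theorem inv_pow_mul_inv_pow_le {a b s : ℝ} (ha : 0 ≤ a) (hb : 0 ≤ b) (hs : 0 < s)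
    (hab : 2 * s ≤ a + b) (n : ℕ) :
    (a ^ n)⁻¹ * (b ^ n)⁻¹ ≤
      (a ^ n)⁻¹ * (max a s ^ n)⁻¹ + (b ^ n)⁻¹ * (max b s ^ n)⁻¹ := by
  wlog h : a ≤ b generalizing a b
  · have := this hb ha (by linarith) (le_of_not_ge h)
    rw [mul_comm, add_comm]
    exact this
  · have hm : max a s ≤ b := max_le h (by linarith)
    have h0 : 0 < max a s := lt_max_of_lt_right hs
    calc _ ≤ (a ^ n)⁻¹ * (max a s ^ n)⁻¹ := by gcongr
      _ ≤ _ := le_add_of_nonneg_right (by positivity)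

theorem setLIntegral_max_pow {n : ℕ} (hn : 1 ≤ n) {s : ℝ} (hs : 0 < s) :
    ∫⁻ r in Ioi (0 : ℝ), ENNReal.ofReal ((max r s ^ (n + 1))⁻¹) =
      ENNReal.ofReal ((1 + (n : ℝ)⁻¹) * (s ^ n)⁻¹) := by
  have hn' : (0 : ℝ) < n := by exact_mod_cast hn
  rw [← Ioc_union_Ioi_eq_Ioi hs.le, lintegral_union measurableSet_Ioi
    (Ioc_disjoint_Ioi le_rfl)]
  have h1 : ∫⁻ r in Ioc 0 s, ENNReal.ofReal ((max r s ^ (n + 1))⁻¹) =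
      ENNReal.ofReal ((s ^ n)⁻¹) := by
    rw [setLIntegral_congr_fun (g := fun _ ↦ ENNReal.ofReal ((s ^ (n + 1))⁻¹)) measurableSet_Ioc
      fun r hr ↦ by simp [max_eq_right hr.2]]
    rw [setLIntegral_const, Real.volume_Ioc, ← ENNReal.ofReal_mul (by positivity)]
    congr 1
    field_simp
    ring
  have h2 : ∫⁻ r in Ioi s, ENNReal.ofReal ((max r s ^ (n + 1))⁻¹) =
      ENNReal.ofReal ((n : ℝ)⁻¹ * (s ^ n)⁻¹) := by
    have hneg : (-(n + 1 : ℕ) : ℝ) < -1 := by push_cast; linarith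
    rw [setLIntegral_congr_fun (g := fun r ↦ ENNReal.ofReal (r ^ (-(n + 1 : ℕ) : ℝ)))
      measurableSet_Ioi fun r hr ↦ by
        have hr' : s < r := hr
        simp only [max_eq_left hr'.le]
        rw [Real.rpow_neg (hs.trans hr').le, Real.rpow_natCast]]
    rw [← ofReal_integral_eq_lintegral_ofReal (integrableOn_Ioi_rpow_of_lt hneg hs),
      integral_Ioi_rpow_of_lt hneg hs]
    · congr 1
      rw [show (-(n + 1 : ℕ) : ℝ) + 1 = -(n : ℝ) by push_cast; ring, Real.rpow_neg hs.le,
        Real.rpow_natCast]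
      field_simp
    · filter_upwards [ae_restrict_mem measurableSet_Ioi] with r hr
      exact Real.rpow_nonneg (hs.trans hr).le _
  rw [h1, h2, ← ENNReal.ofReal_add (by positivity) (by positivity)]
  congr 1
  ring

/-- The surface area of the unit sphere. -/
def sphereArea (d : ℕ) : ℝ := (d : ℝ) * volume.real (ball (0 : Ed d) 1)

theorem sphereArea_pos (hd : 1 ≤ d) : 0 < sphereArea d := by
  have : 0 < volume.real (ball (0 : Ed d) 1) :=
    ENNReal.toReal_pos (measure_ball_pos _ _ one_pos).ne' measure_ball_lt_top.ne
  unfold sphereArea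
  positivity

theorem cdim_eq : cdim d = (sphereArea d)⁻¹ := rfl

theorem lintegral_radial_majorant (hd : 3 ≤ d) {s : ℝ} (hs : 0 < s) :
    ∫⁻ x : Ed d, ENNReal.ofReal ((‖x‖ ^ (d - 1))⁻¹ * (max ‖x‖ s ^ (d - 1))⁻¹) =
      ENNReal.ofReal (sphereArea d * ((1 + ((d - 2 : ℕ) : ℝ)⁻¹) * (s ^ (d - 2))⁻¹)) := by
  have := nontrivial_Ed (d := d) (by omega)
  have hd1 : d - 1 = d - 2 + 1 := by omega
  set g : ℝ → ℝ := fun r ↦ (r ^ (d - 1))⁻¹ * (max r s ^ (d - 1))⁻¹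
  have hg : ∀ r ∈ Ioi (0 : ℝ), r ^ (d - 1) * g r = (max r s ^ (d - 2 + 1))⁻¹ := fun r hr ↦ by
    have hr' : r ^ (d - 1) ≠ 0 := pow_ne_zero _ (mem_Ioi.1 hr).ne'
    simp only [g]
    rw [← mul_assoc, mul_inv_cancel₀ hr', one_mul, ← hd1]
  have hl := setLIntegral_max_pow (n := d - 2) (by omega) hs
  have hnn : ∀ r : ℝ, 0 ≤ (max r s ^ (d - 2 + 1))⁻¹ := fun r ↦ by
    have : 0 < max r s := lt_max_of_lt_right hs
    positivity
  have hi : IntegrableOn (fun r : ℝ ↦ (max r s ^ (d - 2 + 1))⁻¹) (Ioi 0) := by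
    refine ⟨Measurable.aestronglyMeasurable (by fun_prop), ?_⟩
    rw [hasFiniteIntegral_iff_ofReal (.of_forall hnn), hl]
    exact ENNReal.ofReal_lt_top
  have hint : Integrable (fun x : Ed d ↦ g ‖x‖) := by
    rw [integrable_fun_norm_addHaar volume (f := g), finrank_euclideanSpace_fin]
    exact hi.congr_fun (fun r hr ↦ (hg r hr).symm) measurableSet_Ioi
  rw [← ofReal_integral_eq_lintegral_ofReal hint (.of_forall fun x ↦ by positivity),
    integral_fun_norm_addHaar volume g, finrank_euclideanSpace_fin]
  simp only [smul_eq_mul, nsmul_eq_mul]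
  rw [setIntegral_congr_fun measurableSet_Ioi hg]
  rw [← ofReal_integral_eq_lintegral_ofReal hi (.of_forall hnn)] at hl
  rw [ENNReal.ofReal_eq_ofReal_iff (integral_nonneg hnn) (by positivity)] at hl
  rw [hl, sphereArea, mul_assoc]

theorem ofReal_norm_rpow {w : Ed d} (hd : 2 ≤ d) (hw : w ≠ 0) :
    ENNReal.ofReal ‖w‖ ^ ((2 : ℝ) - d) = ENNReal.ofReal ((‖w‖ ^ (d - 2))⁻¹) := by
  have hw' : 0 < ‖w‖ := norm_pos_iff.2 hw
  rw [ENNReal.ofReal_rpow_of_pos hw', ← Real.rpow_natCast, ← Real.rpow_neg hw'.le]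
  congr 2
  rw [Nat.cast_sub hd]
  push_cast
  ring

theorem lintegral_enorm_kern_mul_le (hd : 3 ≤ d) (y z : Ed d) :
    ∫⁻ x, ‖kern d (x - y)‖ₑ * ‖kern d (x - z)‖ₑ ≤
      ENNReal.ofReal (2 * sphereArea d * (1 + ((d - 2 : ℕ) : ℝ)⁻¹) * 2 ^ (d - 2)) *
        ENNReal.ofReal ‖y - z‖ ^ ((2 : ℝ) - d) := by
  have hA := sphereArea_pos (d := d) (by omega)
  rcases eq_or_ne y z with rfl | hyz
  · have hneg : (2 : ℝ) - d < 0 := by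
      have : (3 : ℝ) ≤ d := by exact_mod_cast hd
      linarith
    simp only [sub_self, norm_zero, ENNReal.ofReal_zero, ENNReal.zero_rpow_of_neg hneg]
    rw [ENNReal.mul_top]
    · exact le_top
    · rw [Ne, ENNReal.ofReal_eq_zero, not_le]
      positivity
  have hw : 0 < ‖y - z‖ := norm_pos_iff.2 (sub_ne_zero.2 hyz)
  set s := ‖y - z‖ / 2 with hs_def
  have hs : 0 < s := by positivity
  let G : Ed d → ℝ≥0∞ := fun x ↦
    ENNReal.ofReal ((‖x‖ ^ (d - 1))⁻¹ * (max ‖x‖ s ^ (d - 1))⁻¹)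
  have hGm : Measurable G := by fun_prop
  calc ∫⁻ x, ‖kern d (x - y)‖ₑ * ‖kern d (x - z)‖ₑ
      ≤ ∫⁻ x, (G (x - y) + G (x - z)) := by
        refine lintegral_mono fun x ↦ ?_
        rw [← ofReal_norm, ← ofReal_norm, ← ENNReal.ofReal_mul (by positivity),
          ← ENNReal.ofReal_add (by positivity) (by positivity), norm_kern (by omega),
          norm_kern (by omega)]
        refine ENNReal.ofReal_le_ofReal
          (inv_pow_mul_inv_pow_le (norm_nonneg _) (norm_nonneg _) hs ?_ _)
        rw [hs_def, mul_div_cancel₀ _ two_ne_zero]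
        calc ‖y - z‖ = ‖(x - z) - (x - y)‖ := by congr 1; abel
          _ ≤ ‖x - y‖ + ‖x - z‖ := by rw [add_comm]; exact norm_sub_le _ _
    _ = (∫⁻ x, G x) + ∫⁻ x, G x := by
        rw [lintegral_add_left (by fun_prop), lintegral_sub_right_eq_self G,
          lintegral_sub_right_eq_self G]
    _ = _ := by
        rw [lintegral_radial_majorant hd hs, ofReal_norm_rpow (by omega) (sub_ne_zero.2 hyz),
          ← ENNReal.ofReal_add (by positivity) (by positivity),
          ← ENNReal.ofReal_mul (by positivity)]
        congr 1
        rw [hs_def, div_pow]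
        field_simp
        ring

theorem integrable_inner_kern (hd : 3 ≤ d) {w : Ed d} (hw : w ≠ 0) :
    Integrable fun x ↦ inner ℝ (kern d x) (kern d (w + x)) := by
  have hm := measurable_kern (d := d)
  refine ⟨by fun_prop, ?_⟩
  calc ∫⁻ x, ‖inner ℝ (kern d x) (kern d (w + x))‖ₑ
      ≤ ∫⁻ x, ‖kern d (x - 0)‖ₑ * ‖kern d (x - -w)‖ₑ := by
        refine lintegral_mono fun x ↦ ?_
        rw [sub_zero, sub_neg_eq_add, add_comm x w]
        simp only [← ofReal_norm]
        rw [← ENNReal.ofReal_mul (by positivity)]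
        exact ENNReal.ofReal_le_ofReal (norm_inner_le_norm _ _)
    _ ≤ _ := lintegral_enorm_kern_mul_le hd 0 (-w)
    _ < ⊤ := by
        rw [ofReal_norm_rpow (by omega) (by simpa using hw)]
        exact ENNReal.mul_lt_top ENNReal.ofReal_lt_top ENNReal.ofReal_lt_top

theorem hasDerivAt_inv_norm_pow {n : ℕ} {v θ : Ed d} {r : ℝ} (h : v + r • θ ≠ 0) :
    HasDerivAt (fun t : ℝ ↦ (‖v + t • θ‖ ^ n)⁻¹)
      (-n * ((‖v + r • θ‖ ^ (n + 2))⁻¹ * inner ℝ (v + r • θ) θ)) r := by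
  have hpos : 0 < ‖v + r • θ‖ := norm_pos_iff.2 h
  have h1 : HasDerivAt (fun t : ℝ ↦ v + t • θ) θ r := by
    simpa using ((hasDerivAt_id r).smul_const θ).const_add v
  have h2 : HasDerivAt (fun t : ℝ ↦ ‖v + t • θ‖)
      (‖v + r • θ‖⁻¹ * inner ℝ (v + r • θ) θ) r := by
    have h3 := h1.norm_sq.sqrt (pow_pos hpos 2).ne'
    simp only [Real.sqrt_sq (norm_nonneg _)] at h3
    refine h3.congr_deriv ?_
    field_simp
  refine ((h2.fun_pow n).fun_inv (pow_pos hpos n).ne').congr_deriv ?_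
  rcases n with _ | n
  · simp
  · simp only [Nat.add_sub_cancel]
    field_simp
    ring

/-- Integrating the derivative of `‖·‖⁻ⁿ` along a ray that misses the origin. -/
theorem integral_ray {n : ℕ} (hn : 1 ≤ n) {v θ : Ed d} (hθ : ‖θ‖ = 1)
    (h : ∀ r : ℝ, 0 ≤ r → v + r • θ ≠ 0)
    (hi : IntegrableOn (fun r : ℝ ↦ (‖v + r • θ‖ ^ (n + 2))⁻¹ * inner ℝ (v + r • θ) θ) (Ioi 0)) :
    ∫ r in Ioi (0 : ℝ), (‖v + r • θ‖ ^ (n + 2))⁻¹ * inner ℝ (v + r • θ) θ =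
      (n : ℝ)⁻¹ * (‖v‖ ^ n)⁻¹ := by
  have hlim : Tendsto (fun r : ℝ ↦ (‖v + r • θ‖ ^ n)⁻¹) atTop (𝓝 0) := by
    refine Tendsto.inv_tendsto_atTop ((tendsto_pow_atTop (by omega)).comp ?_)
    refine tendsto_atTop_mono' _ ?_ (tendsto_atTop_add_const_right atTop (-‖v‖) tendsto_id)
    filter_upwards [eventually_ge_atTop 0] with r hr
    have h1 := norm_sub_le (v + r • θ) v
    rw [add_sub_cancel_left, norm_smul, hθ, mul_one, Real.norm_of_nonneg hr] at h1
    simp only [id]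
    linarith
  have key := integral_Ioi_of_hasDerivAt_of_tendsto'
    (fun r hr ↦ hasDerivAt_inv_norm_pow (n := n) (h r hr)) (hi.const_mul (-n : ℝ)) hlim
  rw [integral_const_mul] at key
  have hn' : (n : ℝ) ≠ 0 := by exact_mod_cast (by omega : n ≠ 0)
  simp only [zero_smul, add_zero] at key
  rw [eq_inv_mul_iff_mul_eq₀ hn']
  linarith

theorem ray_integrand (hd : 3 ≤ d) (w θ : Ed d) (hθ : ‖θ‖ = 1) {r : ℝ} (hr : 0 < r) :
    r ^ (d - 1) * inner ℝ (kern d (r • θ)) (kern d (w + r • θ)) =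
      (‖w + r • θ‖ ^ (d - 2 + 2))⁻¹ * inner ℝ (w + r • θ) θ := by
  obtain ⟨n, rfl⟩ : ∃ n, d = n + 2 := ⟨d - 2, by omega⟩
  simp only [kern, real_inner_smul_left, real_inner_smul_right, norm_smul, hθ, mul_one,
    Real.norm_of_nonneg hr.le, real_inner_comm θ, Nat.add_sub_cancel,
    show n + 2 - 1 = n + 1 by omega]
  field_simp
  ring

theorem integral_inner_kern (hd : 3 ≤ d) {w : Ed d} (hw : w ≠ 0) :
    ∫ x, inner ℝ (kern d x) (kern d (w + x)) =
      sphereArea d * (((d - 2 : ℕ) : ℝ)⁻¹ * (‖w‖ ^ (d - 2))⁻¹) := by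
  have := nontrivial_Ed (d := d) (by omega)
  have hint := integrable_inner_kern hd hw
  have hray := ae_integrableOn_ray volume hint
  rw [integral_eq_integral_sphere_ray volume hint]
  rw [finrank_euclideanSpace_fin] at hray ⊢
  have hw0 : ‖w‖ ≠ 0 := norm_ne_zero_iff.2 hw
  let θ₀ : sphere (0 : Ed d) 1 := ⟨-(‖w‖⁻¹ • w), by simp [norm_smul, hw0]⟩
  have hne : ∀ᵐ θ ∂(volume : Measure (Ed d)).toSphere, θ ≠ θ₀ := by
    rw [ae_iff]
    simpa using toSphere_singleton volume
      (by rw [finrank_euclideanSpace_fin]; omega) θ₀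
  rw [integral_congr_ae (g := fun _ ↦ ((d - 2 : ℕ) : ℝ)⁻¹ * (‖w‖ ^ (d - 2))⁻¹), integral_const,
    smul_eq_mul, Measure.toSphere_real_apply_univ, finrank_euclideanSpace_fin, sphereArea]
  filter_upwards [hray, hne] with θ hθi hθ
  have hθ1 : ‖(θ : Ed d)‖ = 1 := norm_eq_of_mem_sphere θ
  have hcongr : EqOn _ _ (Ioi (0 : ℝ)) := fun r hr ↦ ray_integrand hd w θ hθ1 (mem_Ioi.1 hr)
  rw [setIntegral_congr_fun measurableSet_Ioi hcongr]
  refine integral_ray (by omega) hθ1 (fun r hr h0 ↦ hθ (Subtype.ext ?_))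
    (hθi.congr_fun hcongr measurableSet_Ioi)
  have hwr : w = -(r • (θ : Ed d)) := eq_neg_of_add_eq_zero_left h0
  have hnr : ‖w‖ = r := by
    rw [hwr, norm_neg, norm_smul, hθ1, mul_one, Real.norm_of_nonneg hr]
  have hr0 : r ≠ 0 := hnr ▸ hw0
  simp only [θ₀]
  rw [hnr, hwr, smul_neg, neg_neg, smul_smul, inv_mul_cancel₀ hr0, one_smul]

theorem integral_inner_kern_sub (hd : 3 ≤ d) {y z : Ed d} (hyz : y ≠ z) :
    ∫ x, inner ℝ (kern d (x - y)) (kern d (x - z)) =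
      sphereArea d * (((d - 2 : ℕ) : ℝ)⁻¹ * (‖y - z‖ ^ (d - 2))⁻¹) := by
  rw [← integral_inner_kern hd (sub_ne_zero.2 hyz),
    ← integral_sub_right_eq_self (fun x ↦ inner ℝ (kern d x) (kern d (y - z + x))) y]
  refine integral_congr_ae (.of_forall fun x ↦ ?_)
  simp only [show y - z + (x - y) = x - z by abel]

/-- The squared `L²` norm of the kernel convolved with a finite measure `ν` is at most its
Riesz energy. -/
theorem lintegral_norm_integral_kern_sq_le (hd : 3 ≤ d) (ν : Measure (Ed d)) [IsFiniteMeasure ν]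
    [NullSingletonClass ν] :
    ∫⁻ x, ENNReal.ofReal (‖∫ y, kern d (x - y) ∂ν‖ ^ 2) ≤
      ENNReal.ofReal (sphereArea d * ((d - 2 : ℕ) : ℝ)⁻¹) *
        ∫⁻ y, ∫⁻ z, ENNReal.ofReal ‖y - z‖ ^ ((2 : ℝ) - d) ∂ν ∂ν := by
  have hm := measurable_kern (d := d)
  have hA := sphereArea_pos (d := d) (by omega)
  have hn : (0 : ℝ) < (d - 2 : ℕ) := by exact_mod_cast (by omega : 0 < d - 2)
  by_cases hfin : ∫⁻ y, ∫⁻ z, ENNReal.ofReal ‖y - z‖ ^ ((2 : ℝ) - d) ∂ν ∂ν = ⊤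
  · rw [hfin, ENNReal.mul_top]
    · exact le_top
    · rw [Ne, ENNReal.ofReal_eq_zero, not_le]
      positivity
  let F : Ed d → Ed d × Ed d → ℝ := fun x p ↦ inner ℝ (kern d (x - p.1)) (kern d (x - p.2))
  have hprod : ∫⁻ x, (∫⁻ y, ‖kern d (x - y)‖ₑ ∂ν) * (∫⁻ y, ‖kern d (x - y)‖ₑ ∂ν) < ⊤ := by
    calc ∫⁻ x, (∫⁻ y, ‖kern d (x - y)‖ₑ ∂ν) * (∫⁻ y, ‖kern d (x - y)‖ₑ ∂ν)
        = ∫⁻ x, ∫⁻ p : Ed d × Ed d, ‖kern d (x - p.1)‖ₑ * ‖kern d (x - p.2)‖ₑ ∂(ν.prod ν) := by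
          refine lintegral_congr fun x ↦ ?_
          exact (lintegral_prod_mul (f := fun y ↦ ‖kern d (x - y)‖ₑ)
            (g := fun y ↦ ‖kern d (x - y)‖ₑ) (by fun_prop) (by fun_prop)).symm
      _ = ∫⁻ p : Ed d × Ed d, (∫⁻ x, ‖kern d (x - p.1)‖ₑ * ‖kern d (x - p.2)‖ₑ) ∂(ν.prod ν) :=
          lintegral_lintegral_swap (by fun_prop)
      _ ≤ ∫⁻ p : Ed d × Ed d, ENNReal.ofReal (2 * sphereArea d * (1 + ((d - 2 : ℕ) : ℝ)⁻¹) *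
            2 ^ (d - 2)) * ENNReal.ofReal ‖p.1 - p.2‖ ^ ((2 : ℝ) - d) ∂(ν.prod ν) :=
          lintegral_mono fun p ↦ lintegral_enorm_kern_mul_le hd p.1 p.2
      _ < ⊤ := by
          rw [lintegral_const_mul _ (by fun_prop), lintegral_prod _ (by fun_prop)]
          exact ENNReal.mul_lt_top ENNReal.ofReal_lt_top (lt_top_iff_ne_top.2 hfin)
  have hF : Integrable (Function.uncurry F) (volume.prod (ν.prod ν)) := by
    refine ⟨by unfold F; fun_prop, ?_⟩
    refine lt_of_le_of_lt ?_ hprod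
    rw [lintegral_prod _ (by unfold F; fun_prop)]
    refine lintegral_mono fun x ↦ ?_
    rw [← lintegral_prod_mul (f := fun y ↦ ‖kern d (x - y)‖ₑ)
            (g := fun y ↦ ‖kern d (x - y)‖ₑ) (by fun_prop) (by fun_prop)]
    refine lintegral_mono fun p ↦ ?_
    simp only [Function.uncurry, F, ← ofReal_norm]
    rw [← ENNReal.ofReal_mul (by positivity)]
    exact ENNReal.ofReal_le_ofReal (norm_inner_le_norm _ _)
  have hsq : ∀ᵐ x : Ed d, ‖∫ y, kern d (x - y) ∂ν‖ ^ 2 = ∫ p, F x p ∂(ν.prod ν) := by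
    filter_upwards [ae_lt_top (by fun_prop) hprod.ne, hF.prod_right_ae] with x hx hFx
    have hk : Integrable (fun y ↦ kern d (x - y)) ν := by
      refine ⟨Measurable.aestronglyMeasurable (by fun_prop), ?_⟩
      by_contra hc
      have hc' : ∫⁻ y, ‖kern d (x - y)‖ₑ ∂ν = ⊤ := not_lt_top_iff.1 hc
      simp [hc'] at hx
    have hFx' : Integrable (F x) (ν.prod ν) := hFx
    rw [integral_prod _ hFx', ← real_inner_self_eq_norm_sq, ← integral_inner hk]
    refine integral_congr_ae (.of_forall fun y ↦ ?_)
    simp only [F]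
    rw [integral_inner hk, real_inner_comm]
  have hne : ∀ᵐ p ∂(ν.prod ν), p.1 ≠ p.2 := by
    rw [Measure.ae_prod_iff_ae_ae (by measurability)]
    refine .of_forall fun y ↦ ?_
    rw [ae_iff]
    simp
  have hleft : Integrable fun x ↦ ∫ p, F x p ∂(ν.prod ν) := hF.integral_prod_left
  have hright : Integrable (fun p ↦ ∫ x, F x p) (ν.prod ν) := hF.integral_prod_right
  rw [lintegral_congr_ae (hsq.mono fun x hx ↦ by rw [hx]),
    ← ofReal_integral_eq_lintegral_ofReal hleft
      (hsq.mono fun x hx ↦ by simp only [Pi.zero_apply]; rw [← hx]; positivity),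
    integral_integral_swap hF]
  have hval : ∀ᵐ p ∂(ν.prod ν), ENNReal.ofReal (∫ x, F x p) =
      ENNReal.ofReal (sphereArea d * ((d - 2 : ℕ) : ℝ)⁻¹) *
        ENNReal.ofReal ‖p.1 - p.2‖ ^ ((2 : ℝ) - d) := by
    filter_upwards [hne] with p hp
    rw [integral_inner_kern_sub hd hp, ofReal_norm_rpow (by omega) (sub_ne_zero.2 hp),
      ← ENNReal.ofReal_mul (by positivity), mul_assoc]
  have hnn : 0 ≤ᵐ[ν.prod ν] fun p ↦ ∫ x, F x p := by
    filter_upwards [hne] with p hp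
    rw [integral_inner_kern_sub hd hp]
    simp only [Pi.zero_apply]
    positivity
  rw [ofReal_integral_eq_lintegral_ofReal hright hnn, lintegral_congr_ae hval,
    lintegral_const_mul _ (by fun_prop), lintegral_prod _ (by fun_prop)]

end Kernel

/-- Potential energy dominates the squared `L²` norm of the force
field: for `d ≥ 3`, `H(x) = (c_d/(d−2))|x|^{2−d}`, and every nonnegative `ρ ∈ L¹(ℝ^d)`,
`∫ (H∗ρ) ρ dx ≥ ∫ |∇H∗ρ|² dx` (both sides valued in `[0,∞]`). -/
theorem potential_energy_ge_force_L2
    (d : ℕ) (hd : 3 ≤ d)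
    (ρ : Ed d → ℝ) (hρ_meas : Measurable ρ) (hρ_nonneg : ∀ x, 0 ≤ ρ x)
    (hρ_int : Integrable ρ) :
    (∫⁻ x, ENNReal.ofReal (‖gradHconv d ρ x‖ ^ 2)) ≤
      ∫⁻ x, (∫⁻ y, Hkern d (x - y) * ENNReal.ofReal (ρ y)) * ENNReal.ofReal (ρ x) := by
  let f : Ed d → ℝ≥0 := fun y ↦ (ρ y).toNNReal
  have hf : Measurable f := hρ_meas.real_toNNReal
  set ν : Measure (Ed d) := volume.withDensity fun y ↦ ENNReal.ofReal (ρ y) with hν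
  have hfin : IsFiniteMeasure ν := isFiniteMeasure_withDensity_ofReal hρ_int.2
  have := nontrivial_Ed (d := d) (by omega)
  have hat : NullSingletonClass ν := ⟨fun y ↦ withDensity_absolutelyContinuous _ _ (measure_singleton y)⟩
  have hgrad : ∀ x, gradHconv d ρ x = (-cdim d) • ∫ y, kern d (x - y) ∂ν := fun x ↦ by
    have h := integral_withDensity_eq_integral_smul (μ := volume) hf fun y ↦ kern d (x - y)
    rw [gradHconv, hν]
    refine congrArg _ (Eq.trans ?_ h.symm)
    exact integral_congr_ae (.of_forall fun y ↦ by
      simp only [f, NNReal.smul_def, Real.coe_toNNReal _ (hρ_nonneg y)])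
  have hA := sphereArea_pos (d := d) (by omega)
  have hn : (0 : ℝ) < (d : ℝ) - 2 := by
    have : (3 : ℝ) ≤ d := by exact_mod_cast hd
    linarith
  have hρm : Measurable fun y ↦ ENNReal.ofReal (ρ y) := hρ_meas.ennreal_ofReal
  calc ∫⁻ x, ENNReal.ofReal (‖gradHconv d ρ x‖ ^ 2)
      = ENNReal.ofReal (cdim d ^ 2) * ∫⁻ x, ENNReal.ofReal (‖∫ y, kern d (x - y) ∂ν‖ ^ 2) := by
        rw [← lintegral_const_mul' _ _ ENNReal.ofReal_ne_top]
        refine lintegral_congr fun x ↦ ?_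
        rw [hgrad, norm_smul, mul_pow, ENNReal.ofReal_mul (by positivity), norm_neg,
          Real.norm_eq_abs, sq_abs]
    _ ≤ ENNReal.ofReal (cdim d ^ 2) * (ENNReal.ofReal (sphereArea d * ((d - 2 : ℕ) : ℝ)⁻¹) *
        ∫⁻ y, ∫⁻ z, ENNReal.ofReal ‖y - z‖ ^ ((2 : ℝ) - d) ∂ν ∂ν) := by
        gcongr
        exact lintegral_norm_integral_kern_sq_le hd ν
    _ = ENNReal.ofReal (cdim d / ((d : ℝ) - 2)) *
        ∫⁻ y, ∫⁻ z, ENNReal.ofReal ‖y - z‖ ^ ((2 : ℝ) - d) ∂ν ∂ν := by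
        rw [← mul_assoc, ← ENNReal.ofReal_mul (by positivity)]
        congr 2
        rw [cdim_eq, Nat.cast_sub (by omega)]
        push_cast
        field_simp
    _ = ∫⁻ x, (∫⁻ y, Hkern d (x - y) * ENNReal.ofReal (ρ y)) * ENNReal.ofReal (ρ x) := by
        have hinner : ∀ x, ∫⁻ z, ENNReal.ofReal ‖x - z‖ ^ ((2 : ℝ) - d) ∂ν =
            ∫⁻ z, ENNReal.ofReal ‖x - z‖ ^ ((2 : ℝ) - d) * ENNReal.ofReal (ρ z) := fun x ↦ by
          rw [hν, lintegral_withDensity_eq_lintegral_mul _ hρm (by fun_prop)]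
          simp only [Pi.mul_apply, mul_comm]
        rw [← lintegral_const_mul' _ _ ENNReal.ofReal_ne_top, hν,
          lintegral_withDensity_eq_lintegral_mul _ hρm (by fun_prop)]
        refine lintegral_congr fun x ↦ ?_
        simp only [Pi.mul_apply]
        rw [← hν, hinner, mul_comm, ← lintegral_const_mul' _ _ ENNReal.ofReal_ne_top]
        simp only [Hkern, mul_assoc]

end
end
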